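/- Let κ be a weakly inaccessible cardinal (uncountable, regular, and a limit cardinal) such that the sequence ⟨2^μ : μ < κ⟩ is not eventually constant. Then there is a Boolean algebra A with |A| = 2^{<κ} (the supremum of 2^μ for μ < κ) such that A has no disjoint subset of cardinality κ and no independent subset of cardinality κ⁺. -/

import Mathlib

universe u

open Cardinal

/-- A subset `X` of a Boolean algebra is independent if for all disjoint finite subsets
`F`, `G` of `X`, the element `⨅_{x ∈ F} x ⊓ ⨅_{y ∈ G} yᶜ` is nonzero. -/
def IndepSet {A : Type u} [BooleanAlgebra A] (X : Set A) : Prop :=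
  ∀ F G : Finset A, ↑F ⊆ X → ↑G ⊆ X → Disjoint F G →
    F.inf id ⊓ G.inf (fun y => yᶜ) ≠ ⊥

/-- A set of pairwise disjoint nonzero elements of a Boolean algebra. -/
def IsDisjointFamily {A : Type u} [BooleanAlgebra A] (T : Set A) : Prop :=
  (∀ x ∈ T, x ≠ ⊥) ∧ T.PairwiseDisjoint id

theorem mk_Iio_ord_lt {c : Cardinal.{u}} (i : c.ord.ToType) : #(Set.Iio i) < c := by
  simpa using Cardinal.mk_Iio_lt i

/-- The order type below `a` is not approached by fewer than `κ` smaller elements. -/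
def LargeCof {T : Type u} [LinearOrder T] (κ : Cardinal.{u}) (a : T) : Prop :=
  ∀ S : Set T, #S < κ → (∀ s ∈ S, s < a) → ∃ b < a, ∀ s ∈ S, s < b

/-- The product of the initial segments below the `c i` has an everywhere dominating family of
size at most `C`. -/
def DominatedBy {T I : Type u} [LinearOrder T] (C : Cardinal.{u}) (c : I → T) : Prop :=
  ∃ (L : Type u) (F : L → I → T), #L ≤ C ∧ (∀ l i, F l i < c i) ∧
    ∀ g : I → T, (∀ i, g i < c i) → ∃ l, ∀ i, g i ≤ F l i

theorem exists_wellOrder_rec {W : Type*} {B : Type*} [LinearOrder W] [WellFoundedLT W]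
    (P : ∀ w : W, (Set.Iio w → B) → B → Prop) (h : ∀ w p, ∃ b, P w p b) :
    ∃ f : W → B, ∀ w, P w (fun v => f v) (f w) := by
  choose Φ hΦ using h
  let f : W → B := WellFounded.fix (C := fun _ => B) (wellFounded_lt (α := W))
    (fun w p => Φ w (fun v => p v.1 v.2))
  refine ⟨f, fun w => ?_⟩
  have : f w = Φ w (fun v => f v) := WellFounded.fix_eq _ _ _
  rw [this]
  exact hΦ _ _

section scales

variable {κ : Cardinal.{u}} {T I : Type u} [LinearOrder T] {c : I → T}

theorem exists_strict_bound (hc : ∀ i, LargeCof κ (c i)) {L : Type u} (hL : #L < κ)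
    (F : L → I → T) (hF : ∀ l i, F l i < c i) :
    ∃ g : I → T, (∀ i, g i < c i) ∧ ∀ l i, F l i < g i := by
  have : ∀ i, ∃ b < c i, ∀ s ∈ Set.range (fun l => F l i), s < b := fun i =>
    hc i _ (mk_range_le.trans_lt hL) (by rintro _ ⟨l, rfl⟩; exact hF l i)
  choose g hg h using this
  exact ⟨g, hg, fun l i => h i _ ⟨l, rfl⟩⟩

/-- `h` is eventually dominating modulo `D` along the elements below `m`. -/
def IsScale {M : Type u} [LinearOrder M] (D : Ultrafilter I) (c : I → T) (m : M)
    (h : M → I → T) : Prop :=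
  (∀ a i, h a i < c i) ∧ ∀ g : I → T, (∀ i, g i < c i) →
    ∃ b < m, ∀ a, b < a → a < m → ∀ᶠ i in (D : Filter I), g i ≤ h a i

theorem exists_isScale (hκ : 0 < κ) {M : Type u} [LinearOrder M] [WellFoundedLT M] [OrderTop M]
    (D : Ultrafilter I) (hc : ∀ i, LargeCof κ (c i)) (F : M → I → T) (hF : ∀ a i, F a i < c i)
    (hcof : ∀ g : I → T, (∀ i, g i < c i) → ∃ b < (⊤ : M), ∀ᶠ i in (D : Filter I), g i ≤ F b i) :
    ∃ m : M, LargeCof κ m ∧ ∃ h, IsScale D c m h := by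
  let Q : Set M := {m | ∀ g : I → T, (∀ i, g i < c i) →
    ∃ b < m, ∀ᶠ i in (D : Filter I), g i ≤ F b i}
  obtain ⟨m, hm, hmin⟩ := WellFounded.has_min (wellFounded_lt (α := M)) Q ⟨⊤, hcof⟩
  obtain ⟨g₀, hg₀, -⟩ := exists_strict_bound hc (L := PEmpty) (by simpa using hκ)
    (fun l => l.elim) (fun l => l.elim)
  have : ∀ a, ∃ h : I → T, (∀ i, h i < c i) ∧
      (a < m → ∀ b < a, ∀ᶠ i in (D : Filter I), F b i < h i) := by
    intro a
    by_cases ha : a < m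
    · have h1 : a ∉ Q := fun hq => hmin a hq ha
      simp only [Q, Set.mem_ofPred_eq] at h1
      push Not at h1
      obtain ⟨g, hg, h2⟩ := h1
      exact ⟨g, hg, fun _ => h2⟩
    · exact ⟨g₀, hg₀, fun h => absurd h ha⟩
  choose h hh1 hh2 using this
  refine ⟨m, ?_, h, hh1, fun g hg => ?_⟩
  · intro S hS hSm
    by_contra hcon
    push Not at hcon
    obtain ⟨G, hG, hG2⟩ := exists_strict_bound hc hS (fun s i => max (h s.1 i) (F s.1 i))
      (fun s i => max_lt (hh1 _ _) (hF _ _))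
    obtain ⟨b, hb, hbG⟩ := hm G hG
    obtain ⟨s, hs, hbs⟩ := hcon b hb
    obtain hlt | rfl := hbs.lt_or_eq
    · obtain ⟨i, hi1, hi2⟩ := (hbG.and (hh2 s (hSm s hs) b hlt)).exists
      exact absurd ((hi1.trans_lt hi2).trans_le (le_max_left _ (F s i)))
        (hG2 ⟨s, hs⟩ i).not_gt
    · obtain ⟨i, hi1⟩ := hbG.exists
      exact absurd (hi1.trans (le_max_right (h b i) _)) (hG2 ⟨b, hs⟩ i).not_ge
  · obtain ⟨b, hb, hgb⟩ := hm g hg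
    refine ⟨b, hb, fun a hba ham => ?_⟩
    filter_upwards [hgb, hh2 a ham b hba] with i h1 h2 using h1.trans h2.le

/-- A single family is cofinal modulo every ultrafilter that admits a scale of length `m`. -/
theorem exists_uniform_cofinal (hI : Order.succ #I < κ) {M : Type u} [LinearOrder M]
    (hc : ∀ i, LargeCof κ (c i)) (m : M) (hm : LargeCof κ m) :
    ∃ U : M → I → T, (∀ a i, U a i < c i) ∧ ∀ (D : Ultrafilter I) (h : M → I → T),
      IsScale D c m h → ∀ g : I → T, (∀ i, g i < c i) →
        ∃ a, ∀ᶠ i in (D : Filter I), g i ≤ U a i := by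
  by_contra hcon
  push Not at hcon
  let B := {U : M → I → T // ∀ a i, U a i < c i}
  have hcon' : ∀ U : B, ∃ (D : Ultrafilter I) (h : M → I → T) (g : I → T), IsScale D c m h ∧
      (∀ i, g i < c i) ∧ ∀ a, ∀ᶠ i in (D : Filter I), U.1 a i < g i := by
    intro U
    obtain ⟨D, h, hs, g, hg, h2⟩ := hcon U.1 U.2
    exact ⟨D, h, g, hs, hg, h2⟩
  choose D h g hs hg hUg using hcon'
  let W := (Order.succ #I).ord.ToType
  have hW : #W = Order.succ #I := mk_ord_toType _
  obtain ⟨u, hu⟩ := exists_wellOrder_rec (W := W) (B := B)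
    (fun w p b => ∀ v a i, h (p v) a i < b.1 a i) (by
      intro w p
      have : ∀ a, ∃ b : I → T, (∀ i, b i < c i) ∧ ∀ v i, h (p v) a i < b i := fun a =>
        exists_strict_bound hc (((mk_set_le _).trans hW.le).trans_lt hI)
          (fun v => h (p v) a) (fun v i => (hs (p v)).1 a i)
      choose b hb hb2 using this
      exact ⟨⟨b, hb⟩, fun v a i => hb2 a v i⟩)
  obtain ⟨G, hG, hG2⟩ := exists_strict_bound hc (hW.le.trans_lt hI) (fun w => g (u w))
    (fun w i => hg _ i)
  have : ∀ w, ∃ b < m, ∀ a, b < a → a < m →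
      ∀ᶠ i in (D (u w) : Filter I), G i ≤ h (u w) a i := fun w => (hs (u w)).2 G hG
  choose b hbm hb using this
  obtain ⟨a, ham, ha⟩ := hm (Set.range b) (mk_range_le.trans_lt (hW.le.trans_lt hI))
    (by rintro _ ⟨w, rfl⟩; exact hbm w)
  have hex : ∀ w, ∃ i, G i ≤ h (u w) a i ∧ (u w).1 a i < g (u w) i := fun w =>
    ((hb w a (ha _ ⟨w, rfl⟩) ham).and (hUg (u w) a)).exists
  choose j hj1 hj2 using hex
  have hne : ∀ v w, v < w → j v ≠ j w := by
    intro v w hvw heq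
    have h1 := hu w ⟨v, hvw⟩ a (j w)
    have h2 := hj1 v
    rw [heq] at h2
    exact lt_irrefl _ (((h2.trans_lt h1).trans (hj2 w)).trans (hG2 w (j w)))
  have hinj : Function.Injective j := by
    intro v w hvw
    by_contra hne'
    rcases lt_or_gt_of_ne hne' with h | h
    · exact hne _ _ h hvw
    · exact hne _ _ h hvw.symm
  have := mk_le_of_injective hinj
  rw [hW] at this
  exact (Order.lt_succ #I).not_ge this

/-- Either the product is dominated by `χ` many functions, or it is `χ⁺`-directed modulo some
ultrafilter. -/
theorem exists_ultrafilter_directed (hI : Order.succ #I < κ) {χ : Cardinal.{u}} (hχ : ℵ₀ ≤ χ)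
    (hc : ∀ i, LargeCof κ (c i)) (hnd : ¬ DominatedBy χ c) :
    ∃ D : Ultrafilter I, ∀ (L : Type u) (F : L → I → T), #L ≤ χ → (∀ l i, F l i < c i) →
      ∃ g : I → T, (∀ i, g i < c i) ∧ ∀ l, ∀ᶠ i in (D : Filter I), F l i < g i := by
  classical
  by_contra hcon
  push Not at hcon
  have hκ : 0 < κ := bot_lt_of_lt hI
  obtain ⟨g₀, hg₀, -⟩ := exists_strict_bound hc (L := PEmpty) (by simpa using hκ)
    (fun l => l.elim) (fun l => l.elim)
  let M := WithTop χ.ord.ToType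
  have hM : #M = χ := by
    rw [show #M = #(Option χ.ord.ToType) from rfl, mk_option, mk_ord_toType]
    exact add_one_of_aleph0_le hχ
  have hscale : ∀ D : Ultrafilter I, ∃ m : M, LargeCof κ m ∧ ∃ h, IsScale D c m h := by
    intro D
    obtain ⟨L, F, hL, hF, hcof'⟩ := hcon D
    obtain ⟨l₀, -⟩ := hcof' g₀ hg₀
    have : #L ≤ #(χ.ord.ToType) := by rwa [mk_ord_toType]
    obtain ⟨e⟩ := this
    have : Nonempty L := ⟨l₀⟩
    let F' : M → I → T := fun a => match a with
      | ⊤ => g₀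
      | (a : χ.ord.ToType) => F (Function.invFun e a)
    refine exists_isScale hκ D hc F' ?_ ?_
    · rintro (_ | a) i
      · exact hg₀ i
      · exact hF _ _
    · intro g hg
      obtain ⟨l, hl⟩ := hcof' g hg
      refine ⟨(e l : χ.ord.ToType), WithTop.coe_lt_top _, ?_⟩
      have : F' ((e l : χ.ord.ToType) : M) = F l :=
        congrArg F (Function.leftInverse_invFun e.injective l)
      rw [this]
      exact hl
  have hU : ∀ m : M, ∃ U : M → I → T, (∀ a i, U a i < c i) ∧ (LargeCof κ m →
      ∀ (D : Ultrafilter I) (h : M → I → T),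
      IsScale D c m h → ∀ g : I → T, (∀ i, g i < c i) →
        ∃ a, ∀ᶠ i in (D : Filter I), g i ≤ U a i) := by
    intro m
    by_cases hm : LargeCof κ m
    · obtain ⟨U, h1, h2⟩ := exists_uniform_cofinal hI hc m hm
      exact ⟨U, h1, fun _ => h2⟩
    · exact ⟨fun _ => g₀, fun _ => hg₀, fun h => absurd h hm⟩
  choose U hU1 hU2 using hU
  have : Infinite (M × M) := by
    rw [infinite_iff, mk_prod, lift_id, hM]
    rwa [mul_eq_self hχ]
  let E : Finset (M × M) → I → T := fun s i =>
    if hs : s.Nonempty then s.sup' hs (fun p => U p.1 p.2 i) else g₀ i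
  apply hnd
  refine ⟨Finset (M × M), E, ?_, ?_, ?_⟩
  · rw [mk_finset_of_infinite, mk_prod, lift_id, hM, mul_eq_self hχ]
  · intro s i
    simp only [E]
    split_ifs with hs
    · rw [Finset.sup'_lt_iff]
      exact fun p _ => hU1 _ _ _
    · exact hg₀ i
  · intro g hg
    by_contra hdom
    push Not at hdom
    let A : M × M → Set I := fun p => {i | U p.1 p.2 i < g i}
    have hne : (⨅ s : Finset (M × M), Filter.principal (⋂ p ∈ s, A p)).NeBot := by
      refine Filter.iInf_neBot_of_directed' ?_ fun s => ?_
      · refine Antitone.directed_ge fun s t hst => ?_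
        exact Filter.principal_mono.2 (Set.biInter_subset_biInter_left hst)
      · rw [Filter.principal_neBot_iff]
        obtain ⟨i, hi⟩ := hdom s
        refine ⟨i, Set.mem_iInter₂.2 fun p hp => ?_⟩
        have hs : s.Nonempty := ⟨p, hp⟩
        simp only [E, hs, ↓reduceDIte, Finset.sup'_lt_iff] at hi
        exact hi p hp
    obtain ⟨D, hD⟩ := Ultrafilter.exists_le (⨅ s : Finset (M × M), Filter.principal (⋂ p ∈ s, A p))
    obtain ⟨m, hm, h, hs⟩ := hscale D
    obtain ⟨a, ha⟩ := hU2 m hm _ h hs g hg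
    have hA : ∀ᶠ i in (D : Filter I), U m a i < g i := by
      refine hD (Filter.mem_iInf_of_mem {(m, a)} ?_)
      simp [A]
    obtain ⟨i, h1, h2⟩ := (ha.and hA).exists
    exact h2.not_ge h1

end scales

theorem exists_forall_lt_of_isRegular {χ : Cardinal.{u}} (hχ : χ.IsRegular)
    (S : Set χ.ord.ToType) (hS : #S < χ) : ∃ w, ∀ s ∈ S, s < w := by
  by_contra hcon
  push Not at hcon
  have : NoMaxOrder χ.ord.ToType := Cardinal.noMaxOrder hχ.aleph0_le
  have h1 : #(⋃ s ∈ S, Set.Iic s) < χ := by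
    refine (card_biUnion_lt_iff_forall_of_isRegular hχ hS).2 fun s _ => ?_
    obtain ⟨t, ht⟩ := exists_gt s
    exact (mk_le_mk_of_subset fun x (hx : x ≤ s) => hx.trans_lt ht).trans_lt
      (mk_Iio_ord_lt t)
  have h2 : (⋃ s ∈ S, Set.Iic s) = Set.univ := by
    refine Set.eq_univ_of_forall fun w => ?_
    obtain ⟨s, hs, hw⟩ := hcon w
    exact Set.mem_biUnion hs hw
  rw [h2, mk_univ, mk_ord_toType] at h1
  exact lt_irrefl _ h1

section sparse

variable {κ : Cardinal.{u}} {T I : Type u} [LinearOrder T] {c : I → T}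

/-- Every point without large cofinality is approached by a small set. -/
theorem exists_small_cofinal (hκ : 0 < κ) : ∃ E : T → Set T, ∀ d,
    #(E d) < κ ∧ (∀ s ∈ E d, s < d) ∧ (¬ LargeCof κ d → ∀ b < d, ∃ s ∈ E d, b ≤ s) := by
  have : ∀ d : T, ∃ E : Set T, #E < κ ∧ (∀ s ∈ E, s < d) ∧
      (¬ LargeCof κ d → ∀ b < d, ∃ s ∈ E, b ≤ s) := by
    intro d
    by_cases hd : LargeCof κ d
    · exact ⟨∅, by simpa using hκ, by simp, fun h => absurd hd h⟩
    · have h := hd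
      unfold LargeCof at h
      push Not at h
      obtain ⟨S, h1, h2, h3⟩ := h
      exact ⟨S, h1, h2, fun _ => h3⟩
  choose E hE using this
  exact ⟨E, hE⟩

theorem exists_sparse [WellFoundedLT T] (hκ : ℵ₀ < κ) (hlim : ∀ ν < κ, Order.succ ν < κ)
    (hI : #I < κ) {χ : Cardinal.{u}} (hχ : ℵ₀ ≤ χ) (hT : #T ≤ χ) (hc : ∀ i, LargeCof κ (c i))
    (D : Ultrafilter I)
    (hD : ∀ (L : Type u) (F : L → I → T), #L ≤ χ → (∀ l i, F l i < c i) →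
      ∃ g : I → T, (∀ i, g i < c i) ∧ ∀ l, ∀ᶠ i in (D : Filter I), F l i < g i) :
    ∃ f : T → I → T, (∀ a i, f a i < c i) ∧ ∀ d, LargeCof κ d → ∀ P : Set T, #P < κ →
      ∃ b < d, ∀ a < d, (∀ i, f a i ∈ P) → a < b := by
  have hκ0 : 0 < κ := aleph0_pos.trans hκ
  obtain ⟨E, hE⟩ := exists_small_cofinal (T := T) hκ0
  let B := {g : I → T // ∀ i, g i < c i}
  have hbd : ∀ Y : Set B, ∃ b : B, #Y < κ → ∀ y ∈ Y, ∀ i, y.1 i < b.1 i := by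
    intro Y
    by_cases hY : #Y < κ
    · obtain ⟨g, hg, h⟩ := exists_strict_bound hc hY (fun y => y.1.1) (fun y => y.1.2)
      exact ⟨⟨g, hg⟩, fun _ y hy => h ⟨y, hy⟩⟩
    · obtain ⟨g, hg, h⟩ := exists_strict_bound hc (L := PEmpty) (by simpa using hκ0)
        (fun l => l.elim) (fun l => l.elim)
      exact ⟨⟨g, hg⟩, fun h => absurd h hY⟩
  choose bd hbd using hbd
  obtain ⟨f, hf⟩ := exists_wellOrder_rec (W := T) (B := B)
    (fun a p b => (∀ v, ∀ᶠ i in (D : Filter I), (p v).1 i < b.1 i) ∧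
      ∀ d, ∀ e ≤ a, ∀ᶠ i in (D : Filter I), (bd (p '' {v | v.1 ∈ E d ∧ v.1 < e})).1 i < b.1 i) (by
      intro a p
      obtain ⟨g, hg, h⟩ := hD (Set.Iio a ⊕ (T × T))
        (Sum.elim (fun v => (p v).1) (fun q => (bd (p '' {v | v.1 ∈ E q.1 ∧ v.1 < q.2})).1)) (by
          rw [mk_sum, lift_id, lift_id, mk_prod, lift_id]
          exact add_le_of_le hχ ((mk_set_le _).trans hT) (mul_le_of_le hχ hT hT)) (by
          rintro (v | q)
          · exact (p v).2
          · exact (bd _).2)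
      exact ⟨⟨g, hg⟩, fun v => h (Sum.inl v), fun d e _ => h (Sum.inr (d, e))⟩)
  have hf1 : ∀ a, ∀ v < a, ∀ᶠ i in (D : Filter I), (f v).1 i < (f a).1 i :=
    fun a v hv => (hf a).1 ⟨v, hv⟩
  have hf2 : ∀ a d, ∀ᶠ i in (D : Filter I), (bd (f '' {v | v ∈ E d ∧ v < a})).1 i < (f a).1 i := by
    intro a d
    have h := (hf a).2 d a le_rfl
    have h2 : (fun v : Set.Iio a => f v) '' {v | v.1 ∈ E d ∧ v.1 < a} =
        f '' {v | v ∈ E d ∧ v < a} := by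
      ext y
      constructor
      · rintro ⟨v, hv, rfl⟩
        exact ⟨v, hv, rfl⟩
      · rintro ⟨v, hv, rfl⟩
        exact ⟨⟨v, hv.2⟩, hv, rfl⟩
    rwa [h2] at h
  refine ⟨fun a => (f a).1, fun a => (f a).2, fun d hd P hP => ?_⟩
  by_contra hcon
  push Not at hcon
  let ν : Cardinal.{u} := max (max #I #P) ℵ₀
  have hν : ν < κ := max_lt (max_lt hI hP) hκ
  have hreg : (Order.succ ν).IsRegular := isRegular_succ (le_max_right _ _)
  let W := (Order.succ ν).ord.ToType
  have hW : #W < κ := by rw [mk_ord_toType]; exact hlim _ hν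
  have : NoMaxOrder W := Cardinal.noMaxOrder hreg.aleph0_le
  obtain ⟨z, hz⟩ := exists_wellOrder_rec (W := W) (B := {a // a < d ∧ ∀ i, (f a).1 i ∈ P})
    (fun w p b => ∀ v, (p v).1 < b.1) (by
      intro w p
      obtain ⟨b, hbd', hb⟩ := hd (Set.range fun v => (p v).1)
        (mk_range_le.trans_lt ((mk_set_le _).trans_lt hW)) (by
          rintro _ ⟨v, rfl⟩
          exact (p v).2.1)
      obtain ⟨a, ha, haP, hba⟩ := hcon b hbd'
      exact ⟨⟨a, ha, haP⟩, fun v => (hb _ ⟨v, rfl⟩).trans_le hba⟩)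
  obtain ⟨δ, hδ, hmin⟩ := WellFounded.has_min (wellFounded_lt (α := T))
    {t | ∀ w, (z w).1 < t} ⟨d, fun w => (z w).2.1⟩
  have hδbig : ¬ LargeCof κ δ := by
    intro h
    obtain ⟨b, hb, hb2⟩ := h (Set.range fun w => (z w).1) (mk_range_le.trans_lt hW) (by
      rintro _ ⟨w, rfl⟩
      exact hδ w)
    exact hmin b (fun w => hb2 _ ⟨w, rfl⟩) hb
  have hcof : ∀ s < δ, ∃ w, s ≤ (z w).1 := by
    intro s hs
    by_contra h
    push Not at h
    exact hmin s h hs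
  let J := {q : I × P // ∃ b ∈ E δ, q.2.1 < (f b).1 q.1}
  have hJ : #J < Order.succ ν := by
    refine Order.lt_succ_of_le ((mk_subtype_le _).trans ?_)
    rw [mk_prod, lift_id, lift_id]
    exact mul_le_of_le (le_max_right _ _) ((le_max_left _ _).trans (le_max_left _ _))
      ((le_max_right _ _).trans (le_max_left _ _))
  choose β hβE hβ using fun q : J => q.2
  choose w hw using fun q : J => hcof (β q) ((hE δ).2.1 _ (hβE q))
  obtain ⟨w₀, hw₀⟩ := exists_forall_lt_of_isRegular hreg (Set.range w) (mk_range_le.trans_lt hJ)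
  obtain ⟨w₁, hw₁⟩ := exists_gt w₀
  obtain ⟨e, heE, he⟩ := (hE δ).2.2 hδbig (z w₁) (hδ w₁)
  have hae : (z w₀).1 < e := (hz w₁ ⟨w₀, hw₁⟩).trans_le he
  obtain ⟨i, hi1, hi2⟩ := ((hf1 e _ hae).and (hf2 (z w₀).1 δ)).exists
  let q : J := ⟨(i, ⟨(f (z w₀).1).1 i, (z w₀).2.2 i⟩), e, heE, hi1⟩
  have hβlt : β q < (z w₀).1 := (hw q).trans_lt (hz w₀ ⟨w q, hw₀ _ ⟨q, rfl⟩⟩)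
  have h3 := hbd (f '' {v | v ∈ E δ ∧ v < (z w₀).1})
    ((mk_image_le.trans (mk_le_mk_of_subset fun v hv => hv.1)).trans_lt (hE δ).1)
    (f (β q)) ⟨_, ⟨hβE q, hβlt⟩, rfl⟩ i
  exact lt_irrefl _ ((h3.trans hi2).trans (hβ q))

end sparse

/-- The sets of size less than `κ` are covered by `C` many sets of size less than `κ`. -/
def HasCover (κ C : Cardinal.{u}) (T : Type u) : Prop :=
  ∃ (L : Type u) (P : L → Set T), #L ≤ C ∧ (∀ l, #(P l) < κ) ∧
    ∀ X : Set T, #X < κ → ∃ l, X ⊆ P l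

/-- All small products of initial segments with large cofinality bounded by `t` are dominated
by `C` functions. -/
def DominatedUpTo {T : Type u} [LinearOrder T] (κ C : Cardinal.{u}) (t : T) : Prop :=
  ∀ (I : Type u) (c : I → T), #I < κ → (∀ i, LargeCof κ (c i)) → (∀ i, c i ≤ t) →
    DominatedBy C c

theorem DominatedBy.exists_ordToType {T I : Type u} [LinearOrder T] {κ C : Cardinal.{u}} {c : I → T}
    (h : DominatedBy C c) (hκ : 0 < κ) (hc : ∀ i, LargeCof κ (c i)) :
    ∃ F : C.ord.ToType → I → T, (∀ l i, F l i < c i) ∧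
      ∀ g : I → T, (∀ i, g i < c i) → ∃ l, ∀ i, g i ≤ F l i := by
  obtain ⟨L, F, hL, hF, hdom⟩ := h
  obtain ⟨g₀, hg₀, -⟩ := exists_strict_bound hc (L := PEmpty) (by simpa using hκ)
    (fun l => l.elim) (fun l => l.elim)
  obtain ⟨l₀, -⟩ := hdom g₀ hg₀
  have : Nonempty L := ⟨l₀⟩
  rw [← mk_ord_toType C] at hL
  obtain ⟨e⟩ := hL
  refine ⟨fun o => F (Function.invFun e o), fun _ => hF _, fun g hg => ?_⟩
  obtain ⟨l, hl⟩ := hdom g hg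
  refine ⟨e l, fun i => ?_⟩
  change g i ≤ F (Function.invFun e (e l)) i
  rw [Function.leftInverse_invFun e.injective l]
  exact hl i

theorem hasCover_of_dominatedUpTo {T : Type u} [LinearOrder T] [WellFoundedLT T]
    {κ C : Cardinal.{u}} (hκ : ℵ₀ < κ) (hreg : κ.IsRegular) (hC : C ^ (ℵ₀ : Cardinal.{u}) ≤ C) (t : T)
    (h : DominatedUpTo κ C t) : HasCover κ C (Set.Iio t) := by
  have hκ0 : 0 < κ := aleph0_pos.trans hκ
  obtain ⟨E, hE⟩ := exists_small_cofinal (T := T) hκ0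
  let 𝒜 := {A : Set T // #A < κ}
  have hF : ∀ A : 𝒜, ∃ F : C.ord.ToType → {a : T // a ∈ A.1 ∧ LargeCof κ a ∧ a ≤ t} → T,
      (∀ l i, F l i < i.1) ∧ ∀ g : {a : T // a ∈ A.1 ∧ LargeCof κ a ∧ a ≤ t} → T,
        (∀ i, g i < i.1) → ∃ l, ∀ i, g i ≤ F l i := fun A =>
    (h _ (fun a => a.1) ((mk_le_mk_of_subset fun a ha => ha.1).trans_lt A.2) (fun a => a.2.2.1)
      (fun a => a.2.2.2)).exists_ordToType hκ0 (fun a => a.2.2.1)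
  choose F hFlt hFdom using hF
  let step : 𝒜 → C.ord.ToType → 𝒜 := fun A o =>
    ⟨(A.1 ∪ Set.range (F A o)) ∪ ⋃ a ∈ A.1, E a, by
      refine (mk_union_le _ _).trans_lt (add_lt_of_lt hreg.aleph0_le
        ((mk_union_le _ _).trans_lt (add_lt_of_lt hreg.aleph0_le A.2 ?_)) ?_)
      · exact mk_range_le.trans_lt ((mk_le_mk_of_subset fun a ha => ha.1).trans_lt A.2)
      · exact (card_biUnion_lt_iff_forall_of_isRegular hreg A.2).2 fun a _ => (hE a).1⟩
  let start : 𝒜 := ⟨{t}, by rw [mk_singleton]; exact one_lt_aleph0.trans hκ⟩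
  let seq : (ℕ → C.ord.ToType) → ℕ → 𝒜 := fun ω n => Nat.rec start (fun n A => step A (ω n)) n
  refine ⟨ℕ → C.ord.ToType, fun ω => Subtype.val ⁻¹' ⋃ n, (seq ω n).1, ?_, fun ω => ?_, fun X hX => ?_⟩
  · simpa [mk_ord_toType] using hC
  · refine (mk_preimage_of_injective _ _ Subtype.val_injective).trans_lt ?_
    rw [← (Equiv.ulift.{u} (α := ℕ)).surjective.iUnion_comp]
    refine (card_iUnion_lt_iff_forall_of_isRegular hreg ?_).2 fun n => (seq ω n.down).2
    simpa using hκ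
  · have key : ∀ A : 𝒜, ∃ o, ∀ x ∈ X, ∀ a ∈ A.1, x.1 < a → a ≤ t →
        ∃ a' ∈ (step A o).1, x.1 ≤ a' ∧ a' < a := by
      intro A
      have : ∀ a : {a : T // a ∈ A.1 ∧ LargeCof κ a ∧ a ≤ t}, ∃ b < a.1,
          ∀ s ∈ {s : T | s < a.1 ∧ s ∈ Subtype.val '' X}, s < b := fun a =>
        a.2.2.1 _ ((mk_le_mk_of_subset fun s hs => hs.2).trans_lt (mk_image_le.trans_lt hX))
          fun s hs => hs.1
      choose g hg hgX using this
      obtain ⟨o, ho⟩ := hFdom A g hg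
      refine ⟨o, fun x hx a ha hxa hat => ?_⟩
      by_cases hbig : LargeCof κ a
      · refine ⟨F A o ⟨a, ha, hbig, hat⟩, Or.inl (Or.inr ⟨_, rfl⟩), ?_, hFlt _ _ _⟩
        exact ((hgX ⟨a, ha, hbig, hat⟩ x.1 ⟨hxa, x, hx, rfl⟩).le).trans (ho _)
      · obtain ⟨s, hs, hxs⟩ := (hE a).2.2 hbig x.1 hxa
        exact ⟨s, Or.inr (Set.mem_biUnion ha hs), hxs, (hE a).2.1 s hs⟩
    choose o ho using key
    let B : ℕ → 𝒜 := fun n => Nat.rec start (fun _ A => step A (o A)) n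
    have hB : ∀ n, seq (fun n => o (B n)) n = B n := by
      intro n
      induction n with
      | zero => rfl
      | succ n ih =>
        change step (seq _ n) (o (B n)) = step (B n) (o (B n))
        rw [ih]
    refine ⟨fun n => o (B n), fun x hx => ?_⟩
    simp only [Set.mem_preimage, hB]
    obtain ⟨a, ⟨haB, hxa, hat⟩, hmin⟩ := WellFounded.has_min (wellFounded_lt (α := T))
      {a | a ∈ ⋃ n, (B n).1 ∧ x.1 ≤ a ∧ a ≤ t}
      ⟨t, Set.mem_iUnion.2 ⟨0, rfl⟩, x.2.le, le_rfl⟩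
    obtain h1 | h1 := hxa.lt_or_eq
    · obtain ⟨n, hn⟩ := Set.mem_iUnion.1 haB
      obtain ⟨a', ha', hxa', ha'a⟩ := ho (B n) x hx a hn h1 hat
      exact absurd ha'a (hmin a' ⟨Set.mem_iUnion.2 ⟨n + 1, ha'⟩, hxa', ha'a.le.trans hat⟩)
    · rwa [h1]

section cover

variable {κ : Cardinal.{u}} {T : Type u} [LinearOrder T]

theorem HasCover.of_injective {A B : Type u} {C : Cardinal.{u}} (h : HasCover κ C B) {f : A → B}
    (hf : Function.Injective f) : HasCover κ C A := by
  obtain ⟨L, P, hL, hP, hcov⟩ := h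
  refine ⟨L, fun l => f ⁻¹' P l, hL, fun l => (mk_preimage_of_injective _ _ hf).trans_lt (hP l),
    fun X hX => ?_⟩
  obtain ⟨l, hl⟩ := hcov (f '' X) (mk_image_le.trans_lt hX)
  exact ⟨l, Set.image_subset_iff.1 hl⟩

theorem two_power_power_self {σ ρ : Cardinal.{u}} (hσ : ℵ₀ ≤ σ) (hρ : ρ ≤ σ) :
    ((2 : Cardinal.{u}) ^ σ) ^ ρ ≤ 2 ^ σ := by
  rw [← power_mul]
  exact power_le_power_left two_ne_zero (mul_le_of_le hσ le_rfl hρ)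

theorem aleph0_le_two_power {σ : Cardinal.{u}} (hσ : ℵ₀ ≤ σ) : ℵ₀ ≤ (2 : Cardinal.{u}) ^ σ :=
  hσ.trans (cantor σ).le

/-- At a point of large cofinality domination is inherited from below. -/
theorem dominatedUpTo_of_largeCof {χ : Cardinal.{u}} (hχ : ℵ₀ ≤ χ) (hT : #T ≤ χ) {t : T}
    (ht : LargeCof κ t) (hlt : ∀ s < t, DominatedUpTo κ χ s) : DominatedUpTo κ χ t := by
  classical
  intro I c hI hc hct
  obtain ⟨s, hst, hs⟩ := ht {a | a ∈ Set.range c ∧ a < t}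
    ((mk_le_mk_of_subset fun a ha => ha.1).trans_lt (mk_range_le.trans_lt hI)) fun a ha => ha.2
  obtain ⟨L, F, hL, hF, hdom⟩ := hlt s hst {i // c i < t} (fun i => c i.1)
    ((mk_subtype_le _).trans_lt hI) (fun i => hc _) (fun i => (hs _ ⟨⟨_, rfl⟩, i.2⟩).le)
  refine ⟨L × Set.Iio t, fun l i => if h : c i < t then F l.1 ⟨i, h⟩ else l.2.1, ?_, ?_, ?_⟩
  · rw [mk_prod, lift_id, lift_id]
    exact mul_le_of_le hχ hL ((mk_set_le _).trans hT)
  · intro l i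
    dsimp only
    split_ifs with h
    · exact hF _ _
    · exact lt_of_lt_of_le l.2.2 (not_lt.1 h)
  · intro g hg
    obtain ⟨l, hl⟩ := hdom (fun i => g i.1) (fun i => hg _)
    obtain ⟨b, hb, hgb⟩ := ht (Set.range g) (mk_range_le.trans_lt hI) (by
      rintro _ ⟨i, rfl⟩
      exact (hg i).trans_le (hct i))
    refine ⟨(l, ⟨b, hb⟩), fun i => ?_⟩
    dsimp only
    split_ifs with h
    · exact hl ⟨i, h⟩
    · exact (hgb _ ⟨i, rfl⟩).le

/-- At a point of small cofinality domination from below costs a power. -/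
theorem dominatedUpTo_of_not_largeCof (hκ : 0 < κ) {χ : Cardinal.{u}} {t : T} {S : Set T}
    (ht : ¬ LargeCof κ t) (hSt : ∀ s ∈ S, s < t) (hcof : ∀ b < t, ∃ s ∈ S, b ≤ s)
    (hlt : ∀ s < t, DominatedUpTo κ χ s) : DominatedUpTo κ (χ ^ #S) t := by
  intro I c hI hc hct
  have hct' : ∀ i, c i < t := fun i => (hct i).lt_of_ne fun h => ht (h ▸ hc i)
  choose j hjS hj using fun i => hcof (c i) (hct' i)
  have : ∀ s : S, ∃ F : χ.ord.ToType → {i // j i = s} → T, (∀ l i, F l i < c i.1) ∧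
      ∀ g : {i // j i = s} → T, (∀ i, g i < c i.1) → ∃ l, ∀ i, g i ≤ F l i := fun s =>
    (hlt s.1 (hSt _ s.2) {i // j i = s} (fun i => c i.1) ((mk_subtype_le _).trans_lt hI)
      (fun i => hc _) (fun i => (hj i.1).trans i.2.le)).exists_ordToType hκ (fun i => hc _)
  choose F hF hdom using this
  refine ⟨S → χ.ord.ToType, fun l i => F ⟨j i, hjS i⟩ (l ⟨j i, hjS i⟩) ⟨i, rfl⟩, ?_,
    fun l i => hF _ _ _, fun g hg => ?_⟩
  · rw [← power_def, mk_ord_toType]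
  · choose l hl using fun s : S => hdom s (fun i => g i.1) (fun i => hg _)
    exact ⟨l, fun i => hl ⟨j i, hjS i⟩ ⟨i, rfl⟩⟩

theorem exists_hasCover_Iio_top [WellFoundedLT T] [OrderTop T] (hκ : ℵ₀ < κ) (hreg : κ.IsRegular)
    (hlim : ∀ ν < κ, Order.succ ν < κ) {σ : Cardinal.{u}} (hσ : ℵ₀ ≤ σ) (hσκ : σ < κ)
    (hT : #T ≤ 2 ^ σ) : ∃ ρ < κ, σ ≤ ρ ∧ HasCover κ (2 ^ ρ) (Set.Iio (⊤ : T)) := by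
  have hκ0 : 0 < κ := aleph0_pos.trans hκ
  by_cases htop : DominatedUpTo κ (2 ^ σ) (⊤ : T)
  · exact ⟨σ, hσκ, le_rfl, hasCover_of_dominatedUpTo hκ hreg (two_power_power_self hσ hσ) _ htop⟩
  obtain ⟨t, ht, hmin⟩ := WellFounded.has_min (wellFounded_lt (α := T))
    {t | ¬ DominatedUpTo κ (2 ^ σ) t} ⟨⊤, htop⟩
  have hlt : ∀ s < t, DominatedUpTo κ (2 ^ σ) s := fun s hs => by
    by_contra h
    exact hmin s h hs
  have htl : ¬ LargeCof κ t := fun h =>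
    ht (dominatedUpTo_of_largeCof (aleph0_le_two_power hσ) hT h hlt)
  obtain ⟨E, hE⟩ := exists_small_cofinal (T := T) hκ0
  have hdomt := dominatedUpTo_of_not_largeCof hκ0 htl (hE t).2.1 ((hE t).2.2 htl) hlt
  let ρ := max σ #(E t)
  have hρ : ℵ₀ ≤ ρ := hσ.trans (le_max_left _ _)
  have hpow : ((2 : Cardinal.{u}) ^ σ) ^ #(E t) ≤ 2 ^ ρ := by
    rw [← power_mul]
    exact power_le_power_left two_ne_zero (mul_le_of_le hρ (le_max_left _ _) (le_max_right _ _))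
  have hdomt' : DominatedUpTo κ (2 ^ ρ) t := by
    intro I c hI hc hct
    obtain ⟨L, F, hL, hF⟩ := hdomt I c hI hc hct
    exact ⟨L, F, hL.trans hpow, hF⟩
  obtain ⟨L, P, hL, hP, hcov⟩ :=
    hasCover_of_dominatedUpTo hκ hreg (two_power_power_self hρ hρ) t hdomt'
  refine ⟨ρ, max_lt hσκ (hE t).1, le_max_left _ _,
    hasCover_of_dominatedUpTo hκ hreg (two_power_power_self hρ hρ) _ ?_⟩
  have ht' := ht
  simp only [Set.mem_ofPred_eq, DominatedUpTo] at ht'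
  push Not at ht'
  obtain ⟨I, c, hI, hc, hct, hnd⟩ := ht'
  have hχ := aleph0_le_two_power hσ
  obtain ⟨D, hD⟩ := exists_ultrafilter_directed (hlim _ hI) hχ hc hnd
  obtain ⟨f, hf, hsparse⟩ := exists_sparse hκ hlim hI hχ hT hc D hD
  intro J c' hJ hc' _
  choose F hF hFlt using fun (l : L) (i : J) =>
    hsparse (c' i) (hc' i) (Subtype.val '' P l) (mk_image_le.trans_lt (hP l))
  refine ⟨L, F, hL, hF, fun g hg => ?_⟩
  let v : J × I → Set.Iio t := fun p => ⟨f (g p.1) p.2, (hf _ _).trans_le (hct _)⟩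
  obtain ⟨l, hl⟩ := hcov (Set.range v) (mk_range_le.trans_lt (by
    rw [mk_prod, lift_id, lift_id]
    exact mul_lt_of_lt hκ.le hJ hI))
  exact ⟨l, fun i => (hFlt l i (g i) (hg i) fun k => ⟨_, hl ⟨(i, k), rfl⟩, rfl⟩).le⟩

/-- A set of size `2 ^ σ` has a cover of size `2 ^ ρ` for some `ρ` below `κ`. -/
theorem exists_hasCover (hκ : ℵ₀ < κ) (hreg : κ.IsRegular)
    (hlim : ∀ ν < κ, Order.succ ν < κ) {σ : Cardinal.{u}} (hσ : ℵ₀ ≤ σ) (hσκ : σ < κ)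
    {S : Type u} (hS : #S ≤ 2 ^ σ) : ∃ ρ < κ, σ ≤ ρ ∧ HasCover κ (2 ^ ρ) S := by
  let M := WithTop (#S).ord.ToType
  have hM : #M ≤ 2 ^ σ := by
    rw [show #M = #(Option (#S).ord.ToType) from rfl, mk_option, mk_ord_toType]
    exact add_le_of_le (aleph0_le_two_power hσ) hS (one_le_aleph0.trans (aleph0_le_two_power hσ))
  obtain ⟨ρ, h1, h2, h3⟩ := exists_hasCover_Iio_top hκ hreg hlim hσ hσκ hM
  obtain ⟨e⟩ := Cardinal.eq.1 (mk_ord_toType #S).symm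
  refine ⟨ρ, h1, h2, h3.of_injective
    (f := fun s => ⟨((e s : (#S).ord.ToType) : M), WithTop.coe_lt_top _⟩) fun a b hab => ?_⟩
  have := congrArg Subtype.val hab
  exact e.injective (WithTop.coe_injective this)

end cover

/-- Nodes of the full binary tree of height `J`. -/
abbrev BinaryNode (J : Type u) [LinearOrder J] : Type u := Σ i : J, (Set.Iio i → Bool)

/-- The branches all of whose proper initial segments belong to `P`. -/
def branches {J : Type u} [LinearOrder J] (P : Set (BinaryNode J)) : Set (J → Bool) :=
  {x | ∀ i, (⟨i, fun j => x j⟩ : BinaryNode J) ∈ P}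

section trees

variable {κ : Cardinal.{u}}

theorem mk_fun_bool (A : Type u) : #(A → Bool) = 2 ^ #A := by simp

theorem hasCover_of_mk_le {A B : Type u} {C : Cardinal.{u}} (h : HasCover κ C B) (hAB : #A ≤ #B) :
    HasCover κ C A := by
  obtain ⟨e⟩ := hAB
  exact h.of_injective e.injective

theorem hasCover_branches_step (hreg : κ.IsRegular) {J : Type u} [LinearOrder J]
    {ρ : Cardinal.{u}} (hρ : ℵ₀ ≤ ρ) (hρκ : ρ < κ) (hJ : #J ≤ ρ)
    (hP : ∀ P : Set (BinaryNode J), #P < κ → HasCover κ (2 ^ ρ) (branches P))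
    (hcov : ∀ i : J, HasCover κ (2 ^ ρ) (Set.Iio i → Bool)) : HasCover κ (2 ^ ρ) (J → Bool) := by
  have hJκ := hJ.trans_lt hρκ
  choose L P hL hPκ hPcov using hcov
  let N : (∀ i, L i) → Set (BinaryNode J) := fun l => ⋃ i, Sigma.mk i '' P i (l i)
  have hN : ∀ l, #(N l) < κ := fun l =>
    (card_iUnion_lt_iff_forall_of_isRegular hreg hJκ).2 fun i => mk_image_le.trans_lt (hPκ _ _)
  choose L' P' hL' hP'κ hP'cov using fun l => hP (N l) (hN l)
  refine ⟨Σ l : (∀ i, L i), L' l, fun q => Subtype.val '' P' q.1 q.2, ?_,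
    fun q => mk_image_le.trans_lt (hP'κ _ _), fun X hX => ?_⟩
  · have h1 : #(∀ i, L i) ≤ 2 ^ ρ := by
      rw [mk_pi]
      refine (prod_le_prod _ _ hL).trans ?_
      rw [prod_const, lift_id, lift_id]
      exact two_power_power_self hρ hJ
    rw [mk_sigma]
    refine (sum_le_sum _ _ hL').trans ?_
    rw [sum_const, lift_id, lift_id]
    exact mul_le_of_le (aleph0_le_two_power hρ) h1 le_rfl
  · choose l hl using fun i => hPcov i ((fun (x : J → Bool) (j : Set.Iio i) => x j) '' X)
      (mk_image_le.trans_lt hX)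
    have hmem : ∀ x ∈ X, x ∈ branches (N l) := fun x hx i =>
      Set.mem_iUnion.2 ⟨i, _, hl i ⟨x, hx, rfl⟩, rfl⟩
    obtain ⟨m, hm⟩ := hP'cov l (Subtype.val ⁻¹' X)
      ((mk_preimage_of_injective _ _ Subtype.val_injective).trans_lt hX)
    exact ⟨⟨l, m⟩, fun x hx => ⟨⟨x, hmem x hx⟩, hm hx, rfl⟩⟩

theorem hasCover_of_branches (hreg : κ.IsRegular) {ρ : Cardinal.{u}} (hρ : ℵ₀ ≤ ρ) (hρκ : ρ < κ)
    (hP : ∀ (J : Type u) [LinearOrder J] [WellFoundedLT J], #J < κ →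
      ∀ P : Set (BinaryNode J), #P < κ → HasCover κ (2 ^ ρ) (branches P))
    {J : Type u} [LinearOrder J] [WellFoundedLT J] (hJ : #J ≤ ρ) :
    HasCover κ (2 ^ ρ) (J → Bool) := by
  refine hasCover_branches_step hreg hρ hρκ hJ (hP J (hJ.trans_lt hρκ)) fun i => ?_
  induction i using WellFoundedLT.induction with
  | ind i ih =>
    have hi : #(Set.Iio i) ≤ ρ := (mk_set_le _).trans hJ
    refine hasCover_branches_step hreg hρ hρκ hi (hP _ (hi.trans_lt hρκ)) fun j => ?_
    refine hasCover_of_mk_le (ih j.1 j.2) ?_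
    refine mk_le_of_injective (f := fun x k => x ⟨⟨k.1, k.2.trans j.2⟩, k.2⟩) fun x y hxy => ?_
    funext k
    exact congrFun hxy ⟨k.1.1, k.2⟩

theorem exists_many_branches (hκ : ℵ₀ < κ) (hreg : κ.IsRegular)
    (hlim : ∀ ν < κ, Order.succ ν < κ)
    (hnec : ∀ μ₀ : Cardinal.{u}, μ₀ < κ →
      ∃ μ, μ₀ ≤ μ ∧ μ < κ ∧ (2 : Cardinal.{u}) ^ μ ≠ (2 : Cardinal.{u}) ^ μ₀)
    {σ : Cardinal.{u}} (hσκ : σ < κ) :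
    ∃ (J : Type u) (_ : LinearOrder J) (_ : WellFoundedLT J) (P : Set (BinaryNode J)),
      #J < κ ∧ #P < κ ∧ 2 ^ σ ≤ #(branches P) := by
  wlog hσ : ℵ₀ ≤ σ generalizing σ
  · obtain ⟨J, h1, h2, P, h3, h4, h5⟩ := this hκ le_rfl
    exact ⟨J, h1, h2, P, h3, h4,
      (power_le_power_left two_ne_zero (not_le.1 hσ).le).trans h5⟩
  by_contra hcon
  push Not at hcon
  obtain ⟨S, hS⟩ : ∃ S : Type u, #S = 2 ^ σ := ⟨_, mk_out _⟩
  obtain ⟨ρ, hρκ, hσρ, hcov⟩ := exists_hasCover hκ hreg hlim hσ hσκ hS.le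
  have hρ := hσ.trans hσρ
  have hbool : HasCover κ (2 ^ ρ) (ρ.ord.ToType → Bool) :=
    hasCover_of_branches hreg hρ hρκ (fun J _ _ hJ P hP =>
      hasCover_of_mk_le hcov ((hcon J _ ‹_› P hJ hP).le.trans hS.ge)) (mk_ord_toType ρ).le
  have hboolcard : #(ρ.ord.ToType → Bool) = 2 ^ ρ := by
    rw [mk_fun_bool, mk_ord_toType]
  obtain ⟨μ, ⟨hμκ, hμ⟩, hmin⟩ := WellFounded.has_min (wellFounded_lt (α := Cardinal.{u}))
    {μ | μ < κ ∧ (2 : Cardinal.{u}) ^ ρ < 2 ^ μ} (by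
      obtain ⟨μ, h1, h2, h3⟩ := hnec ρ hρκ
      exact ⟨μ, h2, (power_le_power_left two_ne_zero h1).lt_of_ne h3.symm⟩)
  have hμρ : μ ≤ 2 ^ ρ := by
    by_contra h
    exact hmin (2 ^ ρ) ⟨(not_le.1 h).trans hμκ, cantor _⟩ (not_le.1 h)
  have hN : #(BinaryNode μ.ord.ToType) ≤ 2 ^ ρ := by
    rw [mk_sigma]
    refine (sum_le_sum _ (fun _ => 2 ^ ρ) fun i => ?_).trans ?_
    · rw [mk_fun_bool]
      by_contra h
      have hi := mk_Iio_ord_lt i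
      exact hmin _ ⟨hi.trans hμκ, not_le.1 h⟩ hi
    · rw [sum_const, lift_id, lift_id, mk_ord_toType]
      exact mul_le_of_le (aleph0_le_two_power hρ) hμρ le_rfl
  obtain ⟨L, P, hL, hP, hPcov⟩ := hasCover_of_mk_le hbool (hN.trans hboolcard.ge)
  have hx : ∀ x : μ.ord.ToType → Bool, ∃ l, x ∈ branches (P l) := fun x => by
    obtain ⟨l, hl⟩ := hPcov (Set.range fun i => ⟨i, fun j => x j⟩)
      (mk_range_le.trans_lt (by rwa [mk_ord_toType]))
    exact ⟨l, fun i => hl ⟨i, rfl⟩⟩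
  choose l hl using hx
  have hle : #(μ.ord.ToType → Bool) ≤ #(Σ l, branches (P l)) :=
    mk_le_of_injective (f := fun x => ⟨l x, x, hl x⟩) fun x y hxy =>
      congrArg (fun q : Σ l, branches (P l) => (q.2 : μ.ord.ToType → Bool)) hxy
  rw [mk_fun_bool, mk_ord_toType] at hle
  refine (hμ.trans_le hle).not_ge ?_
  rw [mk_sigma]
  refine (sum_le_sum _ (fun _ => 2 ^ σ) fun l =>
    (hcon _ _ inferInstance (P l) (by rwa [mk_ord_toType]) (hP l)).le).trans ?_
  rw [sum_const, lift_id, lift_id]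
  exact mul_le_of_le (aleph0_le_two_power hρ) hL (power_le_power_left two_ne_zero hσρ)

end trees

/-- Pairs `a < b` can be coloured by fewer than `κ` colours so that the intervals `(a, b]` of the
same colour overlap. -/
def IntervalLinked (κ : Cardinal.{u}) (L : Type u) [LinearOrder L] : Prop :=
  ∃ (Q : Type u) (q : L → L → Q), #Q < κ ∧
    ∀ a b a' b', a < b → a' < b' → q a b = q a' b' → a' < b

theorem exists_intervalLinked {κ : Cardinal.{u}} (hκ : ℵ₀ < κ) {J : Type u} [LinearOrder J]
    [WellFoundedLT J] {P : Set (BinaryNode J)} (hP : #P < κ) :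
    IntervalLinked κ {x : Lex (J → Bool) // ofLex x ∈ branches P} := by
  classical
  have hlt : ∀ a b : {x : Lex (J → Bool) // ofLex x ∈ branches P}, a < b →
      ∃ i, (∀ j < i, ofLex a.1 j = ofLex b.1 j) ∧ ofLex a.1 i < ofLex b.1 i := fun a b h => h
  choose d hd1 hd2 using hlt
  refine ⟨Option P, fun a b => if h : a < b then some ⟨⟨d a b h, fun j => ofLex b.1 j⟩, show _ ∈ P from b.2 (d a b h)⟩
    else none, ?_, ?_⟩
  · rw [mk_option]
    exact add_lt_of_lt hκ.le hP (one_lt_aleph0.trans hκ)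
  · intro a b a' b' hab hab' hq
    dsimp only at hq
    rw [dif_pos hab, dif_pos hab', Option.some_inj, Subtype.mk.injEq] at hq
    have h1 := congrArg Sigma.fst hq
    have h2 : ∀ j < d a b hab, ofLex b.1 j = ofLex b'.1 j := by
      intro j hj
      generalize d a b hab = i at *
      dsimp only at h1
      subst h1
      rw [Sigma.mk.injEq] at hq
      exact congrFun (eq_of_heq hq.2) ⟨j, hj⟩
    dsimp only at h1
    refine show a'.1 < b.1 from ⟨d a b hab, fun j hj => ?_, ?_⟩
    · exact (hd1 a' b' hab' j (h1 ▸ hj)).trans (h2 j hj).symm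
    · have h3 := hd2 a b hab
      have h4 := hd2 a' b' hab'
      rw [← h1] at h4
      rw [Bool.lt_iff] at h3 h4
      exact Bool.lt_iff.2 ⟨h4.1, h3.2⟩

theorem exists_large_intervalLinked {κ : Cardinal.{u}} (hκ : ℵ₀ < κ) (hreg : κ.IsRegular)
    (hlim : ∀ ν < κ, Order.succ ν < κ)
    (hnec : ∀ μ₀ : Cardinal.{u}, μ₀ < κ →
      ∃ μ, μ₀ ≤ μ ∧ μ < κ ∧ (2 : Cardinal.{u}) ^ μ ≠ (2 : Cardinal.{u}) ^ μ₀)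
    {σ : Cardinal.{u}} (hσκ : σ < κ) :
    ∃ (L : Type u) (_ : LinearOrder L), 2 ^ σ ≤ #L ∧ #L ≤ 2 ^< κ ∧ IntervalLinked κ L := by
  obtain ⟨J, _, _, P, hJ, hP, hσ⟩ := exists_many_branches hκ hreg hlim hnec hσκ
  refine ⟨{x : Lex (J → Bool) // ofLex x ∈ branches P}, inferInstance, hσ, ?_,
    exists_intervalLinked hκ hP⟩
  refine (mk_subtype_le _).trans (le_trans ?_ (le_powerlt 2 hJ))
  exact (mk_fun_bool J).le

theorem IntervalLinked.exists_colouring {κ : Cardinal.{u}} (hκ : ℵ₀ < κ) {L : Type u}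
    [LinearOrder L] (h : IntervalLinked κ L) :
    ∃ (C : Type u) (col : L → Finset L → C), #C < κ ∧ ∀ x H x' H', col x H = col x' H' →
      ∃ y, (∀ a ∈ H, y ≤ a ↔ x ≤ a) ∧ ∀ a ∈ H', y ≤ a ↔ x' ≤ a := by
  classical
  obtain ⟨Q, q, hQ, hq⟩ := h
  refine ⟨Option (Option Q), fun x H =>
    if h1 : (H.filter (· < x)).Nonempty then
      if h2 : (H.filter (x ≤ ·)).Nonempty then
        some (some (q ((H.filter (· < x)).max' h1) ((H.filter (x ≤ ·)).min' h2)))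
      else some none
    else none, ?_, ?_⟩
  · rw [mk_option, mk_option]
    exact add_lt_of_lt hκ.le (add_lt_of_lt hκ.le hQ (one_lt_aleph0.trans hκ))
      (one_lt_aleph0.trans hκ)
  · intro x H x' H' heq
    have hlo : ∀ (x : L) (H : Finset L), ¬ (H.filter (· < x)).Nonempty → ∀ a ∈ H, x ≤ a := by
      intro x H h a ha
      by_contra hax
      exact h ⟨a, Finset.mem_filter.2 ⟨ha, not_le.1 hax⟩⟩
    have hup : ∀ (x : L) (H : Finset L), ¬ (H.filter (x ≤ ·)).Nonempty → ∀ a ∈ H, a < x := by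
      intro x H h a ha
      by_contra hax
      exact h ⟨a, Finset.mem_filter.2 ⟨ha, not_lt.1 hax⟩⟩
    have hboth : ∀ (x : L) (H : Finset L) (h1 : (H.filter (· < x)).Nonempty)
        (h2 : (H.filter (x ≤ ·)).Nonempty),
        (H.filter (· < x)).max' h1 < (H.filter (x ≤ ·)).min' h2 := by
      intro x H h1 h2
      exact (Finset.mem_filter.1 (Finset.max'_mem _ h1)).2.trans_le
        (Finset.mem_filter.1 (Finset.min'_mem _ h2)).2
    have hpt : ∀ (x : L) (H : Finset L) (h1 : (H.filter (· < x)).Nonempty)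
        (h2 : (H.filter (x ≤ ·)).Nonempty) (y : L), (H.filter (· < x)).max' h1 < y →
        y ≤ (H.filter (x ≤ ·)).min' h2 → ∀ a ∈ H, y ≤ a ↔ x ≤ a := by
      intro x H h1 h2 y hy1 hy2 a ha
      constructor
      · intro hya
        by_contra hxa
        have := Finset.le_max' (H.filter (· < x)) a (Finset.mem_filter.2 ⟨ha, not_le.1 hxa⟩)
        exact (this.trans_lt hy1).not_ge hya
      · intro hxa
        exact hy2.trans (Finset.min'_le (H.filter (x ≤ ·)) a (Finset.mem_filter.2 ⟨ha, hxa⟩))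
    by_cases h1 : (H.filter (· < x)).Nonempty <;> by_cases h1' : (H'.filter (· < x')).Nonempty
    · by_cases h2 : (H.filter (x ≤ ·)).Nonempty <;> by_cases h2' : (H'.filter (x' ≤ ·)).Nonempty
      · simp only [h1, h1', h2, h2', ↓reduceDIte, Option.some_inj] at heq
        have e1 := hboth x H h1 h2
        have e2 := hboth x' H' h1' h2'
        have p1 := hpt x H h1 h2
        have p2 := hpt x' H' h1' h2'
        generalize (H.filter (· < x)).max' h1 = lo at *
        generalize (H.filter (x ≤ ·)).min' h2 = up at *
        generalize (H'.filter (· < x')).max' h1' = lo' at *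
        generalize (H'.filter (x' ≤ ·)).min' h2' = up' at *
        exact ⟨min up up',
          p1 _ (lt_min e1 (hq _ _ _ _ e2 e1 heq.symm)) (min_le_left _ _),
          p2 _ (lt_min (hq _ _ _ _ e1 e2 heq) e2) (min_le_right _ _)⟩
      · simp [h1, h1', h2, h2'] at heq
      · simp [h1, h1', h2, h2'] at heq
      · refine ⟨max x x', fun a ha => ?_, fun a ha => ?_⟩
        · have := hup x H h2 a ha
          simp [this.not_ge]
        · have := hup x' H' h2' a ha
          simp [this.not_ge]
    · simp only [h1, h1', ↓reduceDIte] at heq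
      split_ifs at heq
    · simp only [h1, h1', ↓reduceDIte] at heq
      split_ifs at heq
    · refine ⟨min x x', fun a ha => ?_, fun a ha => ?_⟩
      · have := hlo x H h1 a ha
        simp [this]
      · have := hlo x' H' h1' a ha
        simp [this]

theorem exists_pair_agreeing {κ : Cardinal.{u}} (hκ : ℵ₀ < κ) (hreg : κ.IsRegular) {S : Type u}
    {C : S → Type u} (hC : ∀ s, #(C s) < κ) (n : ℕ) : ∀ {Θ : Type u}, κ ≤ #Θ →
      ∀ (F : Θ → Finset S), (∀ t, (F t).card ≤ n) → ∀ col : Θ → ∀ s, C s,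
        ∃ t t', t ≠ t' ∧ ∀ s ∈ F t, s ∈ F t' → col t s = col t' s := by
  classical
  induction n with
  | zero =>
    intro Θ hΘ F hF col
    have : Nontrivial Θ := one_lt_iff_nontrivial.1 ((one_lt_aleph0.trans hκ).trans_le hΘ)
    obtain ⟨t, t', h⟩ := exists_pair_ne Θ
    refine ⟨t, t', h, fun s hs => ?_⟩
    have := hF t
    simp_all
  | succ n ih =>
    intro Θ hΘ F hF col
    by_cases h : ∃ s, κ ≤ #{t // s ∈ F t}
    · obtain ⟨s, hs⟩ := h
      obtain ⟨k, hk⟩ := infinite_pigeonhole_card (fun t : {t // s ∈ F t} => col t.1 s) κ hs hκ.le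
        (by rw [hreg.cof_ord]; exact hC s)
      obtain ⟨t, t', hne, ht⟩ := ih hk (fun t => (F t.1.1).erase s) (fun t => by
        rw [Finset.card_erase_of_mem t.1.2]
        have := hF t.1.1
        omega) (fun t => col t.1.1)
      refine ⟨t.1.1, t'.1.1, fun h => hne (Subtype.ext (Subtype.ext h)), fun r hr hr' => ?_⟩
      by_cases hrs : r = s
      · subst hrs
        exact t.2.trans t'.2.symm
      · exact ht r (Finset.mem_erase.2 ⟨hrs, hr⟩) (Finset.mem_erase.2 ⟨hrs, hr'⟩)
    · push Not at h
      have hne : #Θ ≠ 0 := ((aleph0_pos.trans hκ).trans_le hΘ).ne'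
      obtain ⟨t₀⟩ := mk_ne_zero_iff.1 hne
      have hU : #(⋃ s ∈ (F t₀ : Set S), {t | s ∈ F t} : Set Θ) < κ := by
        refine (card_biUnion_lt_iff_forall_of_isRegular hreg ?_).2 fun s _ => h s
        exact (lt_aleph0_of_finite _).trans hκ
      have hV : #(({t₀} : Set Θ) ∪ ⋃ s ∈ (F t₀ : Set S), {t | s ∈ F t} : Set Θ) < #Θ := by
        refine (mk_union_le _ _).trans_lt (lt_of_lt_of_le (add_lt_of_lt hκ.le ?_ hU) hΘ)
        rw [mk_singleton]
        exact one_lt_aleph0.trans hκ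
      obtain ⟨t, ht⟩ : ∃ t, t ∉ (({t₀} : Set Θ) ∪ ⋃ s ∈ (F t₀ : Set S), {t | s ∈ F t}) := by
        by_contra hcon
        push Not at hcon
        rw [Set.eq_univ_of_forall hcon, mk_univ] at hV
        exact lt_irrefl _ hV
      refine ⟨t₀, t, fun h => ht (Or.inl h.symm), fun s hs hs' => ?_⟩
      exact absurd (Or.inr (Set.mem_biUnion (Finset.mem_coe.2 hs) hs')) ht

section cutAlgebra

variable {S : Type u} {L : S → Type u} [∀ s, LinearOrder (L s)]

/-- `B` is determined by the finitely many half-lines listed in `G`. -/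
def DeterminedBy (G : Finset (Σ s, L s)) (B : Set (∀ s, L s)) : Prop :=
  ∀ x y : ∀ s, L s, (∀ p ∈ G, x p.1 ≤ p.2 ↔ y p.1 ≤ p.2) → (x ∈ B ↔ y ∈ B)

/-- The free product of the interval algebras of the `L s`, as an algebra of subsets of the
product. -/
def cutAlgebra (L : S → Type u) [∀ s, LinearOrder (L s)] : BooleanSubalgebra (Set (∀ s, L s)) where
  carrier := {B | ∃ G, DeterminedBy G B}
  supClosed' := by
    classical
    rintro A ⟨G, hG⟩ B ⟨H, hH⟩
    refine ⟨G ∪ H, fun x y hxy => ?_⟩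
    exact or_congr (hG x y fun p hp => hxy p (Finset.mem_union_left _ hp))
      (hH x y fun p hp => hxy p (Finset.mem_union_right _ hp))
  infClosed' := by
    classical
    rintro A ⟨G, hG⟩ B ⟨H, hH⟩
    refine ⟨G ∪ H, fun x y hxy => ?_⟩
    exact and_congr (hG x y fun p hp => hxy p (Finset.mem_union_left _ hp))
      (hH x y fun p hp => hxy p (Finset.mem_union_right _ hp))
  compl_mem' := by
    rintro A ⟨G, hG⟩
    exact ⟨G, fun x y hxy => not_congr (hG x y hxy)⟩
  bot_mem' := ⟨∅, fun _ _ _ => Iff.rfl⟩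

theorem mk_cutAlgebra_le {C : Cardinal.{u}} (hC : ℵ₀ ≤ C) (hL : #(Σ s, L s) ≤ C) :
    #(cutAlgebra L) ≤ C := by
  let f : (Σ G : Finset (Σ s, L s), Set (G → Prop)) → Set (∀ s, L s) :=
    fun q => {x | (fun p : q.1 => x p.1.1 ≤ p.1.2) ∈ q.2}
  have hsub : (cutAlgebra L : Set (Set (∀ s, L s))) ⊆ Set.range f := by
    rintro B ⟨G, hG⟩
    refine ⟨⟨G, {v | ∃ x ∈ B, v = fun p => x p.1.1 ≤ p.1.2}⟩, ?_⟩
    ext x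
    constructor
    · rintro ⟨y, hy, hxy⟩
      exact (hG x y fun p hp => iff_of_eq (congrFun hxy ⟨p, hp⟩)).2 hy
    · intro hx
      exact ⟨x, hx, rfl⟩
  refine (mk_le_mk_of_subset hsub).trans (mk_range_le.trans ?_)
  rw [mk_sigma]
  refine (sum_le_sum _ (fun _ => ℵ₀) fun G => mk_le_aleph0).trans ?_
  rw [sum_const, lift_id, lift_id]
  refine mul_le_of_le hC ?_ hC
  rcases finite_or_infinite (Σ s, L s) with h | h
  · exact mk_le_aleph0.trans hC
  · rwa [mk_finset_of_infinite]

theorem le_mk_cutAlgebra [∀ s, Nonempty (L s)] (s : S) : #(L s) ≤ #(cutAlgebra L) := by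
  classical
  refine mk_le_of_injective (f := fun a => ⟨{x | x s ≤ a}, {⟨s, a⟩}, fun x y hxy => ?_⟩)
    fun a b hab => ?_
  · exact hxy ⟨s, a⟩ (Finset.mem_singleton_self _)
  · have h : ∀ x : ∀ s, L s, x s ≤ a ↔ x s ≤ b := fun x =>
      Set.ext_iff.1 (congrArg Subtype.val hab) x
    obtain ⟨x₀⟩ : Nonempty (∀ s, L s) := inferInstance
    refine le_antisymm ?_ ?_
    · simpa using (h (Function.update x₀ s a)).1 (by simp)
    · simpa using (h (Function.update x₀ s b)).2 (by simp)

theorem not_exists_isDisjointFamily {κ : Cardinal.{u}} (hκ : ℵ₀ < κ) (hreg : κ.IsRegular)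
    (hL : ∀ s, IntervalLinked κ (L s)) :
    ¬ ∃ T : Set (cutAlgebra L), IsDisjointFamily T ∧ #T = κ := by
  classical
  rintro ⟨T, ⟨hne, hdis⟩, hT⟩
  choose C col hC hcol using fun s => (hL s).exists_colouring hκ
  have hpt : ∀ t : T, ∃ x, x ∈ t.1.1 := fun t => by
    by_contra h
    exact hne t.1 t.2 (Subtype.ext (Set.not_nonempty_iff_eq_empty.1 h))
  choose x hx using hpt
  choose G hG using fun t : T => t.1.2
  let H : T → ∀ s, Finset (L s) := fun t s =>
    (G t).preimage (Sigma.mk s) sigma_mk_injective.injOn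
  have hH : ∀ t s a, a ∈ H t s ↔ (⟨s, a⟩ : Σ s, L s) ∈ G t := fun t s a => Finset.mem_preimage
  let F : T → Finset S := fun t => (G t).image Sigma.fst
  have hF : ∀ t, ∀ p ∈ G t, p.1 ∈ F t := fun t p hp => Finset.mem_image_of_mem _ hp
  obtain ⟨n, hn⟩ := infinite_pigeonhole_card (fun t : T => ULift.up.{u} (F t).card) κ hT.ge hκ.le
    (by rw [hreg.cof_ord]; simpa using hκ)
  obtain ⟨t, t', htt, hagree⟩ := exists_pair_agreeing hκ hreg hC n.down hn (fun t => F t.1)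
    (fun t => (congrArg ULift.down t.2).le) (fun t s => col s (x t.1 s) (H t.1 s))
  have hne' : t.1.1 ≠ t'.1.1 := fun h => htt (Subtype.ext (Subtype.ext h))
  have hy : ∀ s, ∃ y : L s, (s ∈ F t.1 → ∀ a ∈ H t.1 s, y ≤ a ↔ x t.1 s ≤ a) ∧
      (s ∈ F t'.1 → ∀ a ∈ H t'.1 s, y ≤ a ↔ x t'.1 s ≤ a) := by
    intro s
    by_cases h1 : s ∈ F t.1 <;> by_cases h2 : s ∈ F t'.1
    · obtain ⟨y, hy1, hy2⟩ := hcol s _ _ _ _ (hagree s h1 h2)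
      exact ⟨y, fun _ => hy1, fun _ => hy2⟩
    · exact ⟨x t.1 s, fun _ _ _ => Iff.rfl, fun h => absurd h h2⟩
    · exact ⟨x t'.1 s, fun h => absurd h h1, fun _ _ _ => Iff.rfl⟩
    · exact ⟨x t.1 s, fun h => absurd h h1, fun h => absurd h h2⟩
  choose y hy1 hy2 using hy
  have hm : y ∈ t.1.1.1 := (hG t.1 y (x t.1) fun p hp =>
    hy1 p.1 (hF _ p hp) p.2 ((hH _ _ _).2 hp)).2 (hx t.1)
  have hm' : y ∈ t'.1.1.1 := (hG t'.1 y (x t'.1) fun p hp =>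
    hy2 p.1 (hF _ p hp) p.2 ((hH _ _ _).2 hp)).2 (hx t'.1)
  have hd : Disjoint t.1.1 t'.1.1 := hdis t.1.2 t'.1.2 hne'
  have hbot := congrArg Subtype.val hd.eq_bot
  exact (Set.ext_iff.1 hbot y).1 ⟨hm, hm'⟩

theorem mem_coe_finset_inf {ι X : Type u} {𝒜 : BooleanSubalgebra (Set X)} (Z : Finset ι) (f : ι → 𝒜)
    (x : X) : x ∈ (Z.inf f : 𝒜).1 ↔ ∀ B ∈ Z, x ∈ (f B).1 := by
  classical
  induction Z using Finset.induction_on with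
  | empty => simp
  | insert a Z _ ih =>
    rw [Finset.inf_insert, Finset.forall_mem_insert, ← ih]
    exact Iff.rfl

theorem exists_pow_lt_two_pow (n k : ℕ) : ∃ N : ℕ, (N * n + 1) ^ k < 2 ^ N := by
  have h := tendsto_pow_const_div_const_pow_of_one_lt k (r := 2) one_lt_two
  have h2 : (0 : ℝ) < 1 / ((n : ℝ) + 1) ^ k := by positivity
  obtain ⟨N, h3, hN⟩ := ((h.eventually_lt_const h2).and (Filter.eventually_ge_atTop 1)).exists
  refine ⟨N, ?_⟩
  have h4 : ((N : ℝ) * n + 1) ^ k ≤ ((N : ℝ) * (n + 1)) ^ k := by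
    have : (1 : ℝ) ≤ N := by exact_mod_cast hN
    gcongr
    linarith
  rw [div_lt_div_iff₀ (by positivity) (by positivity), one_mul, ← mul_pow] at h3
  exact_mod_cast h4.trans_lt h3

/-- Only polynomially many patterns are realised by points on sets determined by few half-lines
in few coordinates. -/
theorem two_pow_le_of_patterns {N n : ℕ} {Y : Finset (Set (∀ s, L s))} (hY : Y.card = N)
    (F : Finset S) (G : Set (∀ s, L s) → Finset (Σ s, L s)) (hG : ∀ B ∈ Y, DeterminedBy (G B) B)
    (hF : ∀ B ∈ Y, ∀ p ∈ G B, p.1 ∈ F) (hn : ∀ B ∈ Y, (G B).card ≤ n)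
    (hpat : ∀ Z ⊆ Y, ∃ x : ∀ s, L s, ∀ B ∈ Y, x ∈ B ↔ B ∈ Z) :
    2 ^ N ≤ (N * n + 1) ^ F.card := by
  classical
  let U := Y.biUnion G
  have hU : U.card ≤ N * n := hY ▸ Finset.card_biUnion_le_card_mul _ _ _ hn
  let c : (∀ s, L s) → S → ℕ := fun x s => (U.filter fun p => p.2 < x p.1 ∧ p.1 = s).card
  have hc : ∀ x s, c x s < N * n + 1 := fun x s =>
    Nat.lt_succ_of_le ((Finset.card_filter_le _ _).trans hU)
  have hmono : ∀ x y : ∀ s, L s, ∀ p ∈ U, c x p.1 = c y p.1 → x p.1 ≤ y p.1 →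
      (x p.1 ≤ p.2 ↔ y p.1 ≤ p.2) := by
    intro x y p hp hxy hle
    have hsub : (U.filter fun q => q.2 < x q.1 ∧ q.1 = p.1) ⊆
        U.filter fun q => q.2 < y q.1 ∧ q.1 = p.1 := by
      intro q hq
      rw [Finset.mem_filter] at hq ⊢
      obtain ⟨hqU, hqx, hqp⟩ := hq
      exact ⟨hqU, hqx.trans_le (by rw [hqp]; exact hle), hqp⟩
    have heq := Finset.eq_of_subset_of_card_le hsub hxy.ge
    refine ⟨fun h => ?_, hle.trans⟩
    by_contra hlt
    have hmem : p ∈ U.filter fun q => q.2 < y q.1 ∧ q.1 = p.1 :=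
      Finset.mem_filter.2 ⟨hp, not_le.1 hlt, rfl⟩
    rw [← heq, Finset.mem_filter] at hmem
    exact hmem.2.1.not_ge h
  have hiff : ∀ x y : ∀ s, L s, (∀ s ∈ F, c x s = c y s) → ∀ B ∈ Y, (x ∈ B ↔ y ∈ B) := by
    intro x y hxy B hB
    refine hG B hB x y fun p hp => ?_
    have hpU : p ∈ U := Finset.mem_biUnion.2 ⟨B, hB, hp⟩
    have hcp := hxy p.1 (hF B hB p hp)
    rcases le_total (x p.1) (y p.1) with h | h
    · exact hmono x y p hpU hcp h
    · exact (hmono y x p hpU hcp.symm h).symm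
  choose x hx using fun Z : Y.powerset => hpat Z.1 (Finset.mem_powerset.1 Z.2)
  let Φ : Y.powerset → F → Fin (N * n + 1) := fun Z s => ⟨c (x Z) s, hc _ _⟩
  have hΦ : Function.Injective Φ := by
    intro Z Z' h
    have h1 := hiff (x Z) (x Z') fun s hs => congrArg Fin.val (congrFun h ⟨s, hs⟩)
    refine Subtype.ext (Finset.ext fun B => ?_)
    constructor
    · intro hB
      have hBY := Finset.mem_powerset.1 Z.2 hB
      exact (hx Z' B hBY).1 ((h1 B hBY).1 ((hx Z B hBY).2 hB))
    · intro hB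
      have hBY := Finset.mem_powerset.1 Z'.2 hB
      exact (hx Z B hBY).1 ((h1 B hBY).2 ((hx Z' B hBY).2 hB))
  have := Fintype.card_le_of_injective Φ hΦ
  simpa [hY] using this

theorem not_exists_indepSet {κ : Cardinal.{u}} (hκ : ℵ₀ ≤ κ) (hS : #S ≤ κ) :
    ¬ ∃ X : Set (cutAlgebra L), IndepSet X ∧ #X = Order.succ κ := by
  classical
  rintro ⟨X, hX, hcard⟩
  choose! G hG using fun (B : Set (∀ s, L s)) (h : B ∈ cutAlgebra L) => h
  have : Infinite X := by
    rw [infinite_iff, hcard]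
    exact hκ.trans (Order.le_succ κ)
  have hlt : #(Finset S × ℕ) < #X := by
    rw [hcard]
    refine Order.lt_succ_of_le ?_
    rw [mk_prod]
    simp only [lift_uzero, mk_nat, lift_aleph0]
    refine mul_le_of_le hκ ?_ hκ
    rcases finite_or_infinite S with h | h
    · exact mk_le_aleph0.trans hκ
    · rwa [mk_finset_of_infinite]
  obtain ⟨⟨F, n⟩, hinf⟩ :=
    exists_infinite_fiber (fun B : X => ((G B.1.1).image Sigma.fst, (G B.1.1).card)) hlt
  obtain ⟨N, hN⟩ := exists_pow_lt_two_pow n F.card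
  obtain ⟨Y, hY⟩ := Infinite.exists_subset_card_eq (α := ((fun B : X =>
    ((G B.1.1).image Sigma.fst, (G B.1.1).card)) ⁻¹' {(F, n)})) N
  let e : ((fun B : X => ((G B.1.1).image Sigma.fst, (G B.1.1).card)) ⁻¹' {(F, n)}) ↪
      cutAlgebra L := ⟨fun B => B.1.1, fun B B' h => Subtype.ext (Subtype.ext h)⟩
  let v : cutAlgebra L ↪ Set (∀ s, L s) := Function.Embedding.subtype _
  have hYX : ∀ B ∈ Y.map e, B ∈ X := by
    intro B hB
    obtain ⟨B', -, rfl⟩ := Finset.mem_map.1 hB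
    exact B'.1.2
  have hYG : ∀ B ∈ Y.map e, (G B.1).image Sigma.fst = F ∧ (G B.1).card = n := by
    intro B hB
    obtain ⟨B', -, rfl⟩ := Finset.mem_map.1 hB
    exact Prod.ext_iff.1 B'.2
  refine hN.not_ge (two_pow_le_of_patterns (Y := (Y.map e).map v) (by simp [hY]) F G ?_ ?_ ?_ ?_)
  · intro B hB
    obtain ⟨B', -, rfl⟩ := Finset.mem_map.1 hB
    exact hG _ B'.2
  · intro B hB p hp
    obtain ⟨B', hB', rfl⟩ := Finset.mem_map.1 hB
    rw [← (hYG B' hB').1]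
    exact Finset.mem_image_of_mem _ hp
  · intro B hB
    obtain ⟨B', hB', rfl⟩ := Finset.mem_map.1 hB
    exact (hYG B' hB').2.le
  · intro Z hZ
    have h := hX ((Y.map e).filter (v · ∈ Z)) ((Y.map e).filter (v · ∉ Z))
      (fun B hB => hYX B (Finset.mem_filter.1 hB).1) (fun B hB => hYX B (Finset.mem_filter.1 hB).1)
      (Finset.disjoint_filter_filter_not _ _ _)
    obtain ⟨x, hx1, hx2⟩ : ∃ x, x ∈ ((((Y.map e).filter (v · ∈ Z)).inf id ⊓
        ((Y.map e).filter (v · ∉ Z)).inf (fun y => yᶜ) : cutAlgebra L) : Set (∀ s, L s)) := by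
      by_contra hcon
      exact h (Subtype.ext (Set.not_nonempty_iff_eq_empty.1 hcon))
    refine ⟨x, fun B hB => ?_⟩
    obtain ⟨B', hB', rfl⟩ := Finset.mem_map.1 hB
    constructor
    · intro hx
      by_contra hBZ
      exact (mem_coe_finset_inf _ _ _).1 hx2 B' (Finset.mem_filter.2 ⟨hB', hBZ⟩) hx
    · intro hBZ
      exact (mem_coe_finset_inf _ _ _).1 hx1 B' (Finset.mem_filter.2 ⟨hB', hBZ⟩)

end cutAlgebra

theorem stmt_11 (κ : Cardinal.{u}) (huncount : ℵ₀ < κ) (hreg : κ.IsRegular)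
    (hlimit : ∀ ν : Cardinal.{u}, κ ≠ Order.succ ν)
    (hnec : ∀ μ₀ : Cardinal.{u}, μ₀ < κ → ∃ μ, μ₀ ≤ μ ∧ μ < κ ∧ (2 : Cardinal.{u}) ^ μ ≠ (2 : Cardinal.{u}) ^ μ₀) :
    ∃ (A : Type u) (_ : BooleanAlgebra A), #A = 2 ^< κ ∧
      (¬ ∃ T : Set A, IsDisjointFamily T ∧ #T = κ) ∧
      (¬ ∃ X : Set A, IndepSet X ∧ #X = Order.succ κ) := by
  have hlim : ∀ ν < κ, Order.succ ν < κ := fun ν hν =>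
    (Order.succ_le_of_lt hν).lt_of_ne (hlimit ν).symm
  have hκC : κ ≤ 2 ^< κ := le_of_forall_lt fun ν hν =>
    (cantor ν).trans_le (le_powerlt 2 hν)
  have hC : ℵ₀ ≤ (2 : Cardinal.{u}) ^< κ := huncount.le.trans hκC
  have hσ : ∀ s : κ.ord.ToType, #(Set.Iio s) < κ := mk_Iio_ord_lt
  choose L hord hbelow habove hlinked using fun s : κ.ord.ToType =>
    exists_large_intervalLinked huncount hreg hlim hnec (hσ s)
  have hne : ∀ s, Nonempty (L s) := fun s => by
    rw [← mk_ne_zero_iff]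
    exact ((power_pos _ two_pos).trans_le (hbelow s)).ne'
  refine ⟨cutAlgebra L, inferInstance, le_antisymm ?_ ?_,
    not_exists_isDisjointFamily huncount hreg hlinked,
    not_exists_indepSet huncount.le (mk_ord_toType κ).le⟩
  · refine mk_cutAlgebra_le hC ?_
    rw [mk_sigma]
    refine (sum_le_sum _ (fun _ => 2 ^< κ) habove).trans ?_
    rw [sum_const', mk_ord_toType]
    exact mul_le_of_le hC hκC le_rfl
  · refine powerlt_le.2 fun σ h => ?_
    obtain ⟨T, hT⟩ := le_mk_iff_exists_set.1 (h.le.trans (mk_ord_toType κ).ge)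
    obtain ⟨s, hs⟩ := exists_forall_lt_of_isRegular hreg T (hT.trans_lt h)
    calc (2 : Cardinal.{u}) ^ σ ≤ 2 ^ #(Set.Iio s) :=
          power_le_power_left two_ne_zero (hT.symm.trans_le (mk_le_mk_of_subset hs))
      _ ≤ #(L s) := hbelow s
      _ ≤ #(cutAlgebra L) := le_mk_cutAlgebra s
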